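/- arXiv:2310.17446 — 2 statements merged into one kernel-verified Lean document; each statement's English description precedes it below -/
import Mathlib

section
/- Let (A,m) be a Noetherian local ring and I an m-primary ideal. Let R = R_I(A) be the extended Rees algebra of I, namely the A-subalgebra of the Laurent polynomial ring A[t,t⁻¹] generated by t⁻¹ together with {a·t : a ∈ I}, with its ℤ-grading R_n = I^{max(n,0)}·tⁿ. Let E = ⊕_{n∈ℤ} E_n be a finitely generated ℤ-graded R-module (so R_m·E_n ⊆ E_{m+n} for all m,n) such that E_n = 0 for all sufficiently small n. Then: (i) there exists an integer a ≥ 1 such that t^{-a}·E = 0; and (ii) for every n ∈ ℤ, the A-module E_n has finite length. -/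
noncomputable section

/-- The extended Rees algebra of an ideal `I`: the `A`-subalgebra of the Laurent polynomial
ring `A[t,t⁻¹]` generated by `t⁻¹` together with `{a·t : a ∈ I}`. -/
def extendedReesAlgebra {A : Type*} [CommRing A] (I : Ideal A) :
    Subalgebra A (LaurentPolynomial A) :=
  Algebra.adjoin A ({LaurentPolynomial.T (-1)} ∪
    {p : LaurentPolynomial A | ∃ a ∈ I, p = LaurentPolynomial.C a * LaurentPolynomial.T 1})

theorem T_neg_one_mem {A : Type*} [CommRing A] (I : Ideal A) :
    LaurentPolynomial.T (-1) ∈ extendedReesAlgebra I :=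
  Algebra.subset_adjoin (Set.mem_union_left _ rfl)

/-- A finitely generated module over a Noetherian local ring that is killed by a power of the
maximal ideal has finite length. -/
theorem isFiniteLength_of_pow_maximalIdeal_smul_eq_zero {A M : Type*} [CommRing A]
    [IsNoetherianRing A] [IsLocalRing A] [AddCommGroup M] [Module A M] [Module.Finite A M]
    (N : ℕ) (h : ∀ a ∈ IsLocalRing.maximalIdeal A ^ N, ∀ x : M, a • x = 0) :
    IsFiniteLength A M := by
  rw [isFiniteLength_iff_isNoetherian_isArtinian]
  refine ⟨inferInstance, ?_⟩
  set J := IsLocalRing.maximalIdeal A ^ (N + 1)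
  have hJart : IsArtinianRing (A ⧸ J) := by
    apply IsLocalRing.quotient_artinian_of_mem_minimalPrimes_of_isLocalRing
    refine ⟨⟨inferInstance, Ideal.pow_le_self N.succ_ne_zero⟩, fun q hq _ ↦ ?_⟩
    exact (Ideal.IsPrime.pow_le_iff (hP := hq.1) N.succ_ne_zero).1 hq.2
  have htor : Module.IsTorsionBySet A M J := fun x a ↦
    h a (Ideal.pow_le_pow_right N.le_succ a.2) x
  let _ : Module (A ⧸ J) M := htor.module
  have : IsScalarTower A (A ⧸ J) M := htor.isScalarTower
  have : Module.Finite (A ⧸ J) M := Module.Finite.of_restrictScalars_finite A _ _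
  have : IsArtinian (A ⧸ J) M := inferInstance
  exact isArtinian_of_surjective_algebraMap (R := A ⧸ J) Ideal.Quotient.mk_surjective

theorem C_mul_T_mem_extendedReesAlgebra {A : Type*} [CommRing A] (I : Ideal A) (k : ℤ) {a : A}
    (ha : a ∈ I ^ k.toNat) :
    LaurentPolynomial.C a * LaurentPolynomial.T k ∈ extendedReesAlgebra I := by
  have hnat : ∀ (n : ℕ) (a : A), a ∈ I ^ n →
      LaurentPolynomial.C a * LaurentPolynomial.T (n : ℤ) ∈ extendedReesAlgebra I := by
    intro n
    induction n with
    | zero =>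
      intro a _
      simpa using (extendedReesAlgebra I).algebraMap_mem a
    | succ n ih =>
      intro a ha
      rw [pow_succ] at ha
      induction ha using Submodule.mul_induction_on' with
      | mem_mul_mem x hx y hy =>
        have hy' : LaurentPolynomial.C y * LaurentPolynomial.T 1 ∈ extendedReesAlgebra I :=
          Algebra.subset_adjoin (Or.inr ⟨y, hy, rfl⟩)
        convert mul_mem (ih x hx) hy' using 1
        rw [map_mul, Nat.cast_succ, LaurentPolynomial.T_add]
        ring
      | add x _ y _ hx hy =>
        rw [map_add, add_mul]
        exact add_mem hx hy
  rcases le_total 0 k with hk | hk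
  · simpa [Int.toNat_of_nonneg hk] using hnat k.toNat a ha
  · have h := mul_mem ((extendedReesAlgebra I).algebraMap_mem a)
      (pow_mem (T_neg_one_mem I) (-k).toNat)
    rw [LaurentPolynomial.T_pow] at h
    simpa [Int.toNat_of_nonneg (neg_nonneg.2 hk)] using h

/-- The inclusion `a ↦ a·tᵏ` of `I^{max(k,0)}` as the degree `k` part of the extended Rees
algebra. -/
def reesMonomial {A : Type*} [CommRing A] (I : Ideal A) (k : ℤ) :
    ↥(I ^ k.toNat) →ₗ[A] extendedReesAlgebra I where
  toFun a := ⟨LaurentPolynomial.C (a : A) * LaurentPolynomial.T k,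
    C_mul_T_mem_extendedReesAlgebra I k a.2⟩
  map_add' a b := by
    ext1
    simp [add_mul]
  map_smul' c a := by
    ext1
    simp [LaurentPolynomial.smul_eq_C_mul, mul_assoc]

theorem iSup_range_reesMonomial {A : Type*} [CommRing A] (I : Ideal A) :
    ⨆ k, LinearMap.range (reesMonomial I k) = ⊤ := by
  have hT : ∀ k l : ℤ, (I ^ k.toNat) * (I ^ l.toNat) ≤ I ^ (k + l).toNat := fun k l ↦ by
    rw [← pow_add]
    exact Ideal.pow_le_pow_right (by omega)
  let G : Submonoid (LaurentPolynomial A) :=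
    { carrier := {p | ∃ k : ℤ, ∃ a ∈ I ^ k.toNat,
        p = LaurentPolynomial.C a * LaurentPolynomial.T k}
      one_mem' := ⟨0, 1, by simp, by simp⟩
      mul_mem' := by
        rintro _ _ ⟨k, a, ha, rfl⟩ ⟨l, b, hb, rfl⟩
        refine ⟨k + l, a * b, hT k l (Ideal.mul_mem_mul ha hb), ?_⟩
        rw [map_mul, LaurentPolynomial.T_add]
        ring }
  have hle : Subalgebra.toSubmodule (extendedReesAlgebra I) ≤
      (⨆ k, LinearMap.range (reesMonomial I k)).map
        (extendedReesAlgebra I).val.toLinearMap := by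
    refine (Algebra.adjoin_eq_span _ _).le.trans (Submodule.span_le.2 ?_)
    refine Set.Subset.trans (b := (G : Set (LaurentPolynomial A))) ?_ ?_
    · rw [SetLike.coe_subset_coe, Submonoid.closure_le]
      rintro _ (rfl | ⟨a, ha, rfl⟩)
      · exact ⟨-1, 1, by simp, by simp⟩
      · exact ⟨1, a, by simpa using ha, rfl⟩
    · rintro _ ⟨k, a, ha, rfl⟩
      exact ⟨reesMonomial I k ⟨a, ha⟩, Submodule.mem_iSup_of_mem k ⟨_, rfl⟩, rfl⟩
  refine eq_top_iff.2 fun r _ ↦ ?_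
  obtain ⟨r', hr', h⟩ := hle r.2
  rwa [← Subtype.ext (a1 := r') (a2 := r) h]

/-- Submodules contained in the members of an independent family agree with them as soon as they
have the same supremum as the whole module. -/
theorem iSupIndep.eq_of_le_of_iSup_eq_top {ι R M : Type*} [Ring R] [AddCommGroup M] [Module R M]
    {p q : ι → Submodule R M} (hq : iSupIndep q) (hle : ∀ i, p i ≤ q i) (hp : ⨆ i, p i = ⊤)
    (i : ι) : p i = q i := by
  refine le_antisymm (hle i) fun x hx ↦ ?_
  have htop : p i ⊔ ⨆ (j) (_ : j ≠ i), q j = ⊤ := by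
    rw [eq_top_iff, ← hp]
    refine iSup_le fun j ↦ ?_
    by_cases hj : j = i
    · exact hj ▸ le_sup_left
    · exact (hle j).trans (le_sup_of_le_right (le_iSup₂_of_le j hj le_rfl))
  obtain ⟨y, hy, z, hz, rfl⟩ := Submodule.mem_sup.1 (htop.ge (Submodule.mem_top (x := x)))
  have hz' : z ∈ q i := by simpa using sub_mem hx (hle i hy)
  rw [Submodule.disjoint_def.1 (hq i) z hz' hz, add_zero]
  exact hy

section GradedModule

variable {A : Type*} [CommRing A] {I : Ideal A} {E : Type*} [AddCommGroup E]
  [Module (extendedReesAlgebra I) E] [Module A E]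

theorem exists_T_neg_one_pow_smul_eq_zero [Module.Finite (extendedReesAlgebra I) E]
    {ℰ : ℤ → Submodule A E} (htop : ⨆ n, ℰ n = ⊤)
    (hcompat : ∀ (k n : ℤ) (a : A) (r : extendedReesAlgebra I),
      (r : LaurentPolynomial A) = LaurentPolynomial.C a * LaurentPolynomial.T k →
        ∀ e ∈ ℰ n, r • e ∈ ℰ (k + n))
    (hvanish : ∃ n₀ : ℤ, ∀ n : ℤ, n < n₀ → ℰ n = ⊥) :
    ∃ a : ℕ, 1 ≤ a ∧ ∀ e : E,
      ((⟨LaurentPolynomial.T (-1), T_neg_one_mem I⟩ : extendedReesAlgebra I) ^ a) • e = 0 := by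
  obtain ⟨n₀, hn₀⟩ := hvanish
  set s : extendedReesAlgebra I := ⟨LaurentPolynomial.T (-1), T_neg_one_mem I⟩ with hs
  have hmono : ∀ {m n : ℕ} {e : E}, m ≤ n → s ^ m • e = 0 → s ^ n • e = 0 := by
    intro m n e hmn h
    rw [← Nat.sub_add_cancel hmn, pow_add, mul_smul, h, smul_zero]
  have hpow : ∀ e : E, ∃ k : ℕ, s ^ k • e = 0 := by
    intro e
    refine Submodule.iSup_induction ℰ (motive := fun e ↦ ∃ k : ℕ, s ^ k • e = 0)
      (htop.ge (Submodule.mem_top (x := e))) (fun n e he ↦ ?_) ⟨0, smul_zero _⟩ ?_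
    · refine ⟨(n - n₀ + 1).toNat, ?_⟩
      have h := hcompat (-((n - n₀ + 1).toNat : ℤ)) n 1 (s ^ (n - n₀ + 1).toNat)
        (by simp [hs, LaurentPolynomial.T_pow]) e he
      rwa [hn₀ _ (by omega), Submodule.mem_bot] at h
    · rintro x y ⟨k, hk⟩ ⟨l, hl⟩
      exact ⟨max k l, by
        rw [smul_add, hmono (le_max_left k l) hk, hmono (le_max_right k l) hl, add_zero]⟩
  choose f hf using hpow
  obtain ⟨S, hS⟩ := (Module.Finite.fg_top : (⊤ : Submodule (extendedReesAlgebra I) E).FG)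
  refine ⟨S.sup f + 1, Nat.le_add_left _ _, fun e ↦ ?_⟩
  have he : e ∈ Submodule.span (extendedReesAlgebra I) (S : Set E) := hS ▸ Submodule.mem_top
  induction he using Submodule.span_induction with
  | mem x hx => exact hmono ((Finset.le_sup (f := f) hx).trans (Nat.le_succ _)) (hf x)
  | zero => exact smul_zero _
  | add x y _ _ hx hy => rw [smul_add, hx, hy, add_zero]
  | smul r x _ hx => rw [smul_comm, hx, smul_zero]

variable [IsScalarTower A (extendedReesAlgebra I) E]

theorem fg_graded_component [IsNoetherianRing A] [Module.Finite (extendedReesAlgebra I) E]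
    {ℰ : ℤ → Submodule A E} (hind : iSupIndep ℰ) (htop : ⨆ n, ℰ n = ⊤)
    (hcompat : ∀ (k n : ℤ) (a : A) (r : extendedReesAlgebra I),
      (r : LaurentPolynomial A) = LaurentPolynomial.C a * LaurentPolynomial.T k →
        ∀ e ∈ ℰ n, r • e ∈ ℰ (k + n)) (n : ℤ) :
    (ℰ n).FG := by
  have hspan : Submodule.span (extendedReesAlgebra I) (⋃ n, (ℰ n : Set E)) = ⊤ := by
    refine eq_top_iff.2 fun e _ ↦ ?_
    have h : ⨆ n, ℰ n ≤ (Submodule.span (extendedReesAlgebra I)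
        (⋃ n, (ℰ n : Set E))).restrictScalars A :=
      iSup_le fun n x hx ↦ Submodule.subset_span (Set.mem_iUnion.2 ⟨n, hx⟩)
    exact h (htop ▸ Submodule.mem_top)
  obtain ⟨S, hSsub, hS⟩ := (Submodule.fg_span_iff_fg_span_finset_subset _).1
    (hspan ▸ Module.Finite.fg_top)
  rw [hspan] at hS
  have hdeg : ∀ e : S, ∃ d : ℤ, (e : E) ∈ ℰ d := fun e ↦ Set.mem_iUnion.1 (hSsub e.2)
  choose d hd using hdeg
  let φ (e : S) : extendedReesAlgebra I →ₗ[A] E :=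
    (LinearMap.toSpanSingleton (extendedReesAlgebra I) E e).restrictScalars A
  let P (n : ℤ) : Submodule A E :=
    ⨆ e : S, (LinearMap.range (reesMonomial I (n - d e))).map (φ e)
  have hPle : ∀ n, P n ≤ ℰ n := by
    refine fun n ↦ iSup_le fun e ↦ ?_
    rintro _ ⟨_, ⟨a, rfl⟩, rfl⟩
    have h := hcompat (n - d e) (d e) a (reesMonomial I (n - d e) a) rfl e (hd e)
    rwa [sub_add_cancel] at h
  have hmem : ∀ (e : S) (r : extendedReesAlgebra I), r • (e : E) ∈ ⨆ n, P n := by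
    intro e r
    have hle : (⨆ k, LinearMap.range (reesMonomial I k)).map (φ e) ≤ ⨆ n, P n := by
      rw [Submodule.map_iSup]
      refine iSup_le fun k ↦ le_iSup_of_le (k + d e) (le_iSup_of_le e ?_)
      rw [add_sub_cancel_right]
    refine hle ⟨r, ?_, rfl⟩
    rw [iSup_range_reesMonomial]
    exact Submodule.mem_top
  have hPtop : ⨆ n, P n = ⊤ := by
    refine eq_top_iff.2 fun x _ ↦ ?_
    obtain ⟨f, -, rfl⟩ := Submodule.mem_span_finset.1 (hS.le (Submodule.mem_top (x := x)))
    exact sum_mem fun e he ↦ hmem ⟨e, he⟩ _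
  rw [← hind.eq_of_le_of_iSup_eq_top hPle hPtop n]
  exact Submodule.fg_iSup _ fun e ↦ ((Module.Finite.iff_fg.1 inferInstance).map _)

/-- If `t⁻ᵏ` kills a module over the extended Rees algebra of `I`, then so does `Iᵏ`. -/
theorem smul_eq_zero_of_T_neg_one_pow_smul_eq_zero {k : ℕ} {e : E}
    (h : ((⟨LaurentPolynomial.T (-1), T_neg_one_mem I⟩ : extendedReesAlgebra I) ^ k) • e = 0)
    {a : A} (ha : a ∈ I ^ k) : a • e = 0 := by
  have hmul : reesMonomial I k ⟨a, by simpa using ha⟩ *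
      (⟨LaurentPolynomial.T (-1), T_neg_one_mem I⟩ : extendedReesAlgebra I) ^ k =
        algebraMap A (extendedReesAlgebra I) a := by
    ext1
    change LaurentPolynomial.C a * LaurentPolynomial.T (k : ℤ) *
      LaurentPolynomial.T (-1) ^ k = LaurentPolynomial.C a
    rw [LaurentPolynomial.T_pow, mul_assoc, ← LaurentPolynomial.T_add]
    simp
  rw [← algebraMap_smul (extendedReesAlgebra I) a e, ← hmul, mul_smul, h, smul_zero]

end GradedModule

/-- **Statement 9.** Let `(A,m)` be Noetherian local and `I` an `m`-primary ideal.  Let `E`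
be a finitely generated `ℤ`-graded module over the extended Rees algebra `R = R_I(A)` (the
grading `ℰ` is by `A`-submodules, internal, and compatible with the grading
`Rₖ = I^{max(k,0)}·tᵏ` of `R`), with `ℰ n = 0` for all sufficiently small `n`.  Then
(i) some power `t^{-a}` (`a ≥ 1`) kills `E`, and (ii) every graded component `ℰ n` has
finite length over `A`. -/
theorem graded_module_over_extendedRees_finite_length
    {A : Type*} [CommRing A] [IsNoetherianRing A] [IsLocalRing A] (I : Ideal A)
    (hI : ∃ c : ℕ, 1 ≤ c ∧ IsLocalRing.maximalIdeal A ^ c ≤ I ∧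
      I ≤ IsLocalRing.maximalIdeal A)
    (E : Type*) [AddCommGroup E] [Module (extendedReesAlgebra I) E]
    [Module A E] [IsScalarTower A (extendedReesAlgebra I) E]
    [Module.Finite (extendedReesAlgebra I) E]
    (ℰ : ℤ → Submodule A E)
    (hinternal : DirectSum.IsInternal ℰ)
    (hcompat : ∀ (k n : ℤ) (a : A) (r : extendedReesAlgebra I),
      (r : LaurentPolynomial A) = LaurentPolynomial.C a * LaurentPolynomial.T k →
        ∀ e ∈ ℰ n, r • e ∈ ℰ (k + n))
    (hvanish : ∃ n₀ : ℤ, ∀ n : ℤ, n < n₀ → ℰ n = ⊥) :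
    (∃ a : ℕ, 1 ≤ a ∧ ∀ e : E,
      ((⟨LaurentPolynomial.T (-1), T_neg_one_mem I⟩ : extendedReesAlgebra I) ^ a) • e = 0) ∧
    (∀ n : ℤ, IsFiniteLength A ↥(ℰ n)) := by
  obtain ⟨c, -, hc, -⟩ := hI
  have htop := hinternal.submodule_iSup_eq_top
  have hkill := exists_T_neg_one_pow_smul_eq_zero htop hcompat hvanish
  refine ⟨hkill, fun n ↦ ?_⟩
  obtain ⟨k, -, hk⟩ := hkill
  have : Module.Finite A (ℰ n) := Module.Finite.iff_fg.2
    (fg_graded_component hinternal.submodule_iSupIndep htop hcompat n)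
  refine isFiniteLength_of_pow_maximalIdeal_smul_eq_zero (c * k) fun a ha x ↦ Subtype.ext ?_
  rw [pow_mul] at ha
  exact smul_eq_zero_of_T_neg_one_pow_smul_eq_zero (hk x) (Ideal.pow_right_mono hc k ha)
end
end

section
/- Let (A,m) be a Noetherian local ring with infinite residue field k = A/m, and let I be an m-primary ideal. Let R = R_I(A) be the extended Rees algebra of I, namely the A-subalgebra of the Laurent polynomial ring A[t,t⁻¹] generated by t⁻¹ together with {a·t : a ∈ I}, with its ℤ-grading R_n = I^{max(n,0)}·tⁿ. Let E = ⊕_{n∈ℤ} E_n be a finitely generated ℤ-graded R-module with E_n = 0 for all sufficiently small n. Then there exist finitely many proper k-subspaces W_1, …, W_s of the k-vector space I/mI such that for every x ∈ I whose class in I/mI lies outside W_1 ∪ ⋯ ∪ W_s, the kernel of the multiplication map x·t : E → E has finite length as an A-module. -/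
noncomputable section

theorem C_mul_T_one_mem {A : Type*} [CommRing A] {I : Ideal A} {a : A} (ha : a ∈ I) :
    LaurentPolynomial.C a * LaurentPolynomial.T 1 ∈ extendedReesAlgebra I :=
  Algebra.subset_adjoin (Set.mem_union_right _ ⟨a, ha, rfl⟩)

/-- For `x ∈ I`, the element `x·t` of the extended Rees algebra. -/
def xT {A : Type*} [CommRing A] {I : Ideal A} (x : ↥I) : extendedReesAlgebra I :=
  ⟨LaurentPolynomial.C (x : A) * LaurentPolynomial.T 1, C_mul_T_one_mem x.2⟩

open IsLocalRing

theorem isNoetherianRing_extendedReesAlgebra {A : Type*} [CommRing A] [IsNoetherianRing A]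
    (I : Ideal A) : IsNoetherianRing (extendedReesAlgebra I) := by
  obtain ⟨s, hs⟩ := IsNoetherian.noetherian I
  let f : A →ₗ[A] LaurentPolynomial A :=
    (LinearMap.mulRight A (LaurentPolynomial.T 1)).comp (Algebra.linearMap A (LaurentPolynomial A))
  have hI : {p : LaurentPolynomial A | ∃ a ∈ I, p = LaurentPolynomial.C a * LaurentPolynomial.T 1}
      = (Submodule.span A (f '' (s : Set A)) : Set (LaurentPolynomial A)) := by
    rw [← Submodule.map_span, hs]
    ext p
    exact exists_congr fun a => and_congr_right fun _ => eq_comm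
  have hfg : (extendedReesAlgebra I).FG := by
    classical
    rw [extendedReesAlgebra, hI, Algebra.adjoin_union, Algebra.adjoin_span]
    refine Subalgebra.FG.sup ?_ ?_
    · simpa using Subalgebra.fg_adjoin_finset (R := A) {LaurentPolynomial.T (R := A) (-1)}
    · simpa using Subalgebra.fg_adjoin_finset (R := A) (s.image f)
  have := Subalgebra.fg_iff_finiteType _ |>.1 hfg
  exact Algebra.FiniteType.isNoetherianRing A _

namespace extendedReesAlgebra

variable {A : Type*} [CommRing A] {I : Ideal A}

/-- The element `t⁻¹` of the extended Rees algebra. -/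
def tInv (I : Ideal A) : extendedReesAlgebra I :=
  ⟨LaurentPolynomial.T (-1), Algebra.subset_adjoin (Set.mem_union_left _ rfl)⟩

/-- The map `x ↦ x·t` as an `A`-linear map. -/
def xTLinearMap (I : Ideal A) : I →ₗ[A] extendedReesAlgebra I where
  toFun := xT
  map_add' x y := Subtype.ext <| by simp [xT, add_mul]
  map_smul' a x := Subtype.ext <| by simp [xT, LaurentPolynomial.smul_eq_C_mul, mul_assoc]

theorem tInv_mul_xT (x : I) :
    tInv I * xT x = algebraMap A (extendedReesAlgebra I) (x : A) := by
  refine Subtype.ext ?_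
  change LaurentPolynomial.T (-1) * (LaurentPolynomial.C (x : A) * LaurentPolynomial.T 1) =
    LaurentPolynomial.C (x : A)
  rw [mul_left_comm, ← LaurentPolynomial.T_add]
  simp

theorem exists_sub_algebraMap_mem {P : Ideal (extendedReesAlgebra I)} (ht : tInv I ∈ P)
    (hx : ∀ x : I, xT x ∈ P) (r : extendedReesAlgebra I) :
    ∃ a : A, r - algebraMap A (extendedReesAlgebra I) a ∈ P := by
  obtain ⟨r, hr⟩ := r
  refine Algebra.adjoin_induction
    (p := fun r hr => ∃ a : A, (⟨r, hr⟩ : extendedReesAlgebra I) - algebraMap A _ a ∈ P)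
    ?_ ?_ ?_ ?_ hr
  · rintro y (rfl | ⟨a, ha, rfl⟩)
    · exact ⟨0, by simpa using! ht⟩
    · exact ⟨0, by simpa using! hx ⟨a, ha⟩⟩
  · intro a
    refine ⟨a, ?_⟩
    convert P.zero_mem
    exact sub_eq_zero.2 rfl
  · rintro y z hy hz ⟨a, ha⟩ ⟨b, hb⟩
    refine ⟨a + b, ?_⟩
    convert P.add_mem ha hb using 1
    rw [map_add, ← add_sub_add_comm]
    rfl
  · rintro y z hy hz ⟨a, ha⟩ ⟨b, hb⟩
    refine ⟨a * b, ?_⟩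
    convert P.add_mem (P.mul_mem_right ⟨z, hz⟩ ha) (P.mul_mem_left (algebraMap A _ a) hb) using 1
    rw [map_mul, sub_mul, mul_sub, sub_add_sub_cancel]
    rfl

/-- Outside finitely many proper subspaces of `I/mI`, multiplication by `x·t` on `M` has
finite length kernel. -/
def FiniteLengthKerOutsideSubspaces [IsLocalRing A] (I : Ideal A) (M : Type*) [AddCommGroup M]
    [Module (extendedReesAlgebra I) M] : Prop :=
  ∃ S : Set (Submodule A (I ⧸ (maximalIdeal A • ⊤ : Submodule A I))), S.Finite ∧
    (∀ W ∈ S, W ≠ ⊤) ∧ ∀ x : I, (∀ W ∈ S, Submodule.Quotient.mk x ∉ W) →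
      ∀ [Module A M] [IsScalarTower A (extendedReesAlgebra I) M], IsFiniteLength A
        (LinearMap.ker
          ((LinearMap.lsmul (extendedReesAlgebra I) M (xT x)).restrictScalars A))

theorem map_mkQ_ne_top [IsNoetherianRing A] [IsLocalRing A] {Q : Submodule A I} (hQ : Q ≠ ⊤) :
    Q.map (maximalIdeal A • ⊤ : Submodule A I).mkQ ≠ ⊤ := by
  intro h
  refine hQ (top_le_iff.1 (Submodule.le_of_le_smul_of_le_jacobson_bot
    (IsNoetherian.noetherian _) (maximalIdeal_le_jacobson _) (le_of_eq ?_)))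
  simpa [Submodule.comap_map_mkQ, sup_comm] using
    (congr_arg (Submodule.comap (maximalIdeal A • ⊤ : Submodule A I).mkQ) h).symm

theorem isFiniteLength_of_equiv_quotient [IsLocalRing A] {c : ℕ} (hc : maximalIdeal A ^ c ≤ I)
    {N : Type*} [AddCommGroup N] [Module (extendedReesAlgebra I) N] [Module A N]
    [IsScalarTower A (extendedReesAlgebra I) N] {P : Ideal (extendedReesAlgebra I)} [P.IsPrime]
    (e : N ≃ₗ[extendedReesAlgebra I] extendedReesAlgebra I ⧸ P)
    (ht : tInv I ∈ P) (hx : ∀ x : I, xT x ∈ P) : IsFiniteLength A N := by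
  have hm : maximalIdeal A ≤ P.comap (algebraMap A (extendedReesAlgebra I)) := by
    refine Ideal.IsPrime.le_of_pow_le (n := c) (hc.trans fun a ha => ?_)
    rw [Ideal.mem_comap, ← tInv_mul_xT ⟨a, ha⟩]
    exact P.mul_mem_right _ ht
  let g : A →ₗ[A] N :=
    (e.symm.toLinearMap.restrictScalars A).comp
      ((Ideal.Quotient.mkₐ A P).toLinearMap.comp
        (Algebra.linearMap A (extendedReesAlgebra I)))
  have hg : ∀ a, g a = e.symm (Ideal.Quotient.mk P (algebraMap A _ a)) := fun a => rfl
  have hker : maximalIdeal A ≤ LinearMap.ker g := fun a ha => by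
    rw [LinearMap.mem_ker, hg, Ideal.Quotient.eq_zero_iff_mem.2 (Ideal.mem_comap.1 (hm ha))]
    exact LinearEquiv.map_zero _
  have hlen : IsFiniteLength A (A ⧸ maximalIdeal A) :=
    by
    have : IsSimpleModule A (A ⧸ maximalIdeal A) :=
      isSimpleModule_iff_isCoatom.2 (maximalIdeal.isMaximal A).out
    exact isFiniteLength_iff_isNoetherian_isArtinian.2 ⟨inferInstance, inferInstance⟩
  refine hlen.of_surjective (f := (maximalIdeal A).liftQ g hker) fun n => ?_
  obtain ⟨r, hr⟩ := Ideal.Quotient.mk_surjective (e n)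
  obtain ⟨a, ha⟩ := exists_sub_algebraMap_mem ht hx r
  refine ⟨Submodule.Quotient.mk a, ?_⟩
  rw [Submodule.liftQ_apply, hg, ← Ideal.Quotient.eq.2 ha, hr, e.symm_apply_apply]

theorem FiniteLengthKerOutsideSubspaces.of_equiv_quotient [IsNoetherianRing A] [IsLocalRing A]
    {c : ℕ} (hc : maximalIdeal A ^ c ≤ I) {N : Type*} [AddCommGroup N]
    [Module (extendedReesAlgebra I) N] {P : Ideal (extendedReesAlgebra I)} [P.IsPrime]
    (e : N ≃ₗ[extendedReesAlgebra I] extendedReesAlgebra I ⧸ P) (ht : tInv I ∈ P) :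
    FiniteLengthKerOutsideSubspaces I N := by
  by_cases hx : ∀ x : I, xT x ∈ P
  · refine ⟨∅, Set.finite_empty, by simp, fun x _ _ _ => ?_⟩
    exact (isFiniteLength_of_equiv_quotient hc e ht hx).of_injective
      (Submodule.subtype_injective _)
  · let Q : Submodule A I := (P.restrictScalars A).comap (xTLinearMap I)
    have hQ : Q ≠ ⊤ := fun h => hx fun x => (h ▸ Submodule.mem_top : x ∈ Q)
    refine ⟨{Q.map (maximalIdeal A • ⊤ : Submodule A I).mkQ}, Set.finite_singleton _,
      by simpa using map_mkQ_ne_top hQ, fun x hxW _ _ => ?_⟩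
    have hxP : xT x ∉ P := fun h => hxW _ rfl ⟨x, h, rfl⟩
    suffices h : LinearMap.ker
        ((LinearMap.lsmul (extendedReesAlgebra I) N (xT x)).restrictScalars A) = ⊥ by
      rw [h]
      exact .of_subsingleton
    rw [eq_bot_iff]
    intro n hn
    have hn' : xT x • n = 0 := hn
    obtain ⟨r, hr⟩ := Ideal.Quotient.mk_surjective (e n)
    have h0 : Ideal.Quotient.mk P (xT x * r) = 0 := by
      rw [map_mul, hr, ← Ideal.Quotient.algebraMap_eq, ← Algebra.smul_def, ← map_smul, hn', map_zero]
    have hrP := (Ideal.IsPrime.mem_or_mem ‹_›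
      (Ideal.Quotient.eq_zero_iff_mem.1 h0)).resolve_left hxP
    rw [Ideal.Quotient.eq_zero_iff_mem.2 hrP] at hr
    exact (Submodule.mem_bot A).2 (e.map_eq_zero_iff.1 hr.symm)

theorem FiniteLengthKerOutsideSubspaces.of_exact [IsLocalRing A]
    {N₁ N₂ N₃ : Type*} [AddCommGroup N₁] [AddCommGroup N₂] [AddCommGroup N₃]
    [Module (extendedReesAlgebra I) N₁] [Module (extendedReesAlgebra I) N₂]
    [Module (extendedReesAlgebra I) N₃]
    (f : N₁ →ₗ[extendedReesAlgebra I] N₂) (g : N₂ →ₗ[extendedReesAlgebra I] N₃)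
    (hf : Function.Injective f) (hfg : Function.Exact f g)
    (h₁ : FiniteLengthKerOutsideSubspaces I N₁) (h₃ : FiniteLengthKerOutsideSubspaces I N₃) :
    FiniteLengthKerOutsideSubspaces I N₂ := by
  obtain ⟨S, hS, hS', h₁⟩ := h₁
  obtain ⟨T, hT, hT', h₃⟩ := h₃
  refine ⟨S ∪ T, hS.union hT, fun W hW => hW.elim (hS' W) (hT' W), fun x hx _ _ => ?_⟩
  let _ : Module A N₁ := .compHom N₁ (algebraMap A (extendedReesAlgebra I))
  let _ : Module A N₃ := .compHom N₃ (algebraMap A (extendedReesAlgebra I))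
  have : IsScalarTower A (extendedReesAlgebra I) N₁ := .of_compHom ..
  have : IsScalarTower A (extendedReesAlgebra I) N₃ := .of_compHom ..
  have h₁ := isFiniteLength_iff_isNoetherian_isArtinian.1
    (h₁ x fun W hW => hx W (Or.inl hW))
  have h₃ := isFiniteLength_iff_isNoetherian_isArtinian.1
    (h₃ x fun W hW => hx W (Or.inr hW))
  obtain ⟨_, _⟩ := h₁
  obtain ⟨_, _⟩ := h₃
  let f' := (f.restrictScalars A).restrict
    (p := LinearMap.ker
        ((LinearMap.lsmul (extendedReesAlgebra I) N₁ (xT x)).restrictScalars A))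
    (q := LinearMap.ker
        ((LinearMap.lsmul (extendedReesAlgebra I) N₂ (xT x)).restrictScalars A))
    fun n hn => by
      have hn' : xT x • n = 0 := hn
      change xT x • f n = 0
      rw [← map_smul, hn', map_zero]
  let g' := (g.restrictScalars A).restrict
    (p := LinearMap.ker
        ((LinearMap.lsmul (extendedReesAlgebra I) N₂ (xT x)).restrictScalars A))
    (q := LinearMap.ker
        ((LinearMap.lsmul (extendedReesAlgebra I) N₃ (xT x)).restrictScalars A))
    fun n hn => by
      have hn' : xT x • n = 0 := hn
      change xT x • g n = 0
      rw [← map_smul, hn', map_zero]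
  have hker : LinearMap.range f' = LinearMap.ker g' := by
    ext ⟨n, hn⟩
    have hn' : xT x • n = 0 := hn
    constructor
    · rintro ⟨⟨y, hy⟩, hyn⟩
      have hyn' : f y = n := congr_arg Subtype.val hyn
      exact Subtype.ext ((hfg n).2 ⟨y, hyn'⟩)
    · intro h
      obtain ⟨y, rfl⟩ := (hfg n).1 (congr_arg Subtype.val h)
      refine ⟨⟨y, hf ?_⟩, rfl⟩
      change f (xT x • y) = f 0
      rw [map_smul, hn', map_zero]
  exact isFiniteLength_iff_isNoetherian_isArtinian.2
    ⟨isNoetherian_of_range_eq_ker f' g' hker, isArtinian_of_range_eq_ker f' g' hker⟩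

theorem finiteLengthKerOutsideSubspaces [IsNoetherianRing A] [IsLocalRing A]
    {c : ℕ} (hc : maximalIdeal A ^ c ≤ I) {M : Type*} [AddCommGroup M]
    [Module (extendedReesAlgebra I) M] [Module.Finite (extendedReesAlgebra I) M]
    (hM : ∀ e : M, ∃ N : ℕ, tInv I ^ N • e = 0) : FiniteLengthKerOutsideSubspaces I M := by
  have := isNoetherianRing_extendedReesAlgebra I
  revert hM
  refine IsNoetherianRing.induction_on_isQuotientEquivQuotientPrime (extendedReesAlgebra I)
    (M := M) inferInstance
    (motive := fun M _ _ _ => (∀ e : M, ∃ N : ℕ, tInv I ^ N • e = 0) →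
      FiniteLengthKerOutsideSubspaces I M) ?_ ?_ ?_
  · intro N _ _ _ _ _
    exact ⟨∅, Set.finite_empty, by simp, fun x _ _ _ => .of_subsingleton⟩
  · intro N _ _ _ p e hN
    have := p.2
    refine .of_equiv_quotient hc e ?_
    obtain ⟨n, hn⟩ := hN (e.symm 1)
    rw [← map_smul, e.symm.map_eq_zero_iff, Algebra.smul_def, mul_one] at hn
    exact p.2.mem_of_pow_mem n (Ideal.Quotient.eq_zero_iff_mem.1 hn)
  · intro N₁ _ _ _ N₂ _ _ _ N₃ _ _ _ f g hf hg hfg h₁ h₃ h₂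
    refine .of_exact f g hf hfg (h₁ fun e => ?_) (h₃ fun e => ?_)
    · obtain ⟨n, hn⟩ := h₂ (f e)
      exact ⟨n, hf (by rw [map_smul, hn, map_zero])⟩
    · obtain ⟨e, rfl⟩ := hg e
      obtain ⟨n, hn⟩ := h₂ e
      exact ⟨n, by rw [← map_smul, hn, map_zero]⟩

theorem exists_tInv_pow_smul_eq_zero {E : Type*} [AddCommGroup E]
    [Module (extendedReesAlgebra I) E] [Module A E]
    {ℰ : ℤ → Submodule A E} (htop : iSup ℰ = ⊤)
    (htInv : ∀ n, ∀ e ∈ ℰ n, tInv I • e ∈ ℰ (-1 + n))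
    {n₀ : ℤ} (hn₀ : ∀ n < n₀, ℰ n = ⊥) (e : E) : ∃ N : ℕ, tInv I ^ N • e = 0 := by
  have he : e ∈ iSup ℰ := htop ▸ Submodule.mem_top
  induction he using Submodule.iSup_induction' with
  | mem n e he =>
    have hpow : ∀ N : ℕ, tInv I ^ N • e ∈ ℰ (n - N) := fun N => by
      induction N with
      | zero => simpa using he
      | succ N ih =>
        rw [pow_succ', mul_smul]
        convert htInv _ _ ih using 2
        push_cast
        ring
    refine ⟨(n - n₀).toNat + 1, ?_⟩
    have h := hpow ((n - n₀).toNat + 1)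
    rwa [hn₀ _ (by omega), Submodule.mem_bot] at h
  | zero => exact ⟨0, smul_zero _⟩
  | add x y _ _ hx hy =>
    obtain ⟨a, ha⟩ := hx
    obtain ⟨b, hb⟩ := hy
    refine ⟨a + b, ?_⟩
    rw [smul_add, pow_add, mul_smul, mul_smul, hb, smul_zero, add_zero, ← mul_smul, mul_comm,
      mul_smul, ha, smul_zero]

end extendedReesAlgebra

/-- **Statement 10.** Let `(A,m)` be Noetherian local with infinite residue field and `I` an
`m`-primary ideal.  Let `E` be a finitely generated `ℤ`-graded module over the extended Rees
algebra `R = R_I(A)` with `ℰ n = 0` for `n ≪ 0`.  Then there are finitely many proper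
subspaces `W₁, …, Wₛ` of `I/mI` such that for every `x ∈ I` whose class in `I/mI` avoids
`W₁ ∪ ⋯ ∪ Wₛ`, the kernel of multiplication by `x·t` on `E` has finite length over `A`. -/
theorem exists_finitely_many_proper_subspaces_ker_finite_length
    {A : Type*} [CommRing A] [IsNoetherianRing A] [IsLocalRing A]
    [Infinite (IsLocalRing.ResidueField A)] (I : Ideal A)
    (hI : ∃ c : ℕ, 1 ≤ c ∧ IsLocalRing.maximalIdeal A ^ c ≤ I ∧
      I ≤ IsLocalRing.maximalIdeal A)
    (E : Type*) [AddCommGroup E] [Module (extendedReesAlgebra I) E]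
    [Module A E] [IsScalarTower A (extendedReesAlgebra I) E]
    [Module.Finite (extendedReesAlgebra I) E]
    (ℰ : ℤ → Submodule A E)
    (hinternal : DirectSum.IsInternal ℰ)
    (hcompat : ∀ (k n : ℤ) (a : A) (r : extendedReesAlgebra I),
      (r : LaurentPolynomial A) = LaurentPolynomial.C a * LaurentPolynomial.T k →
        ∀ e ∈ ℰ n, r • e ∈ ℰ (k + n))
    (hvanish : ∃ n₀ : ℤ, ∀ n : ℤ, n < n₀ → ℰ n = ⊥) :
    ∃ (s : ℕ)
      (W : Fin s → Submodule A
        (↥I ⧸ (IsLocalRing.maximalIdeal A • ⊤ : Submodule A ↥I))),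
      (∀ i, W i ≠ ⊤) ∧
      ∀ x : ↥I, (∀ i, Submodule.Quotient.mk x ∉ W i) →
        IsFiniteLength A
          ↥(LinearMap.ker
            ((LinearMap.lsmul (extendedReesAlgebra I) E (xT x)).restrictScalars A)) := by
  obtain ⟨c, -, hc, -⟩ := hI
  obtain ⟨n₀, hn₀⟩ := hvanish
  obtain ⟨S, hS, hS', h⟩ := extendedReesAlgebra.finiteLengthKerOutsideSubspaces hc
    (extendedReesAlgebra.exists_tInv_pow_smul_eq_zero hinternal.submodule_iSup_eq_top
      (fun n => hcompat (-1) n 1 (extendedReesAlgebra.tInv I)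
        (by simp [extendedReesAlgebra.tInv])) hn₀)
  obtain ⟨s, W, -, rfl⟩ := hS.fin_param
  exact ⟨s, W, fun i => hS' _ ⟨i, rfl⟩, fun x hx => h x (by rintro _ ⟨i, rfl⟩; exact hx i)⟩
end
end
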